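/- Let 𝔸 = (A_n)_{n∈ℕ} be a sequence of invertible linear operators on ℝ^d and 𝒮 = (‖·‖_n)_{n∈ℕ} a sequence of norms on ℝ^d for which there exist K,a>0 such that ‖𝒜(m,n)x‖_m ≤ K(m/n)^a‖x‖_n and ‖𝒜(n,m)x‖_n ≤ K(m/n)^a‖x‖_m for all m≥n in ℕ and x∈ℝ^d. Let B_n := 𝒜(2^{n+1},2^n) for n∈ℤ⁺, 𝔹 = (B_n)_{n∈ℤ⁺}, and 𝒮̃ = (‖·‖_{2^n})_{n∈ℤ⁺}. Then there exist an integer r with 1≤r≤d and positive reals a_1≤b_1<a_2≤b_2<···<a_r≤b_r such that Σ_{ED,𝔹,𝒮̃} = ⋃_{i=1}^r [a_i,b_i] and Σ_{PD,𝔸,𝒮} = ⋃_{i=1}^r [log a_i / log 2, log b_i / log 2]. -/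

import Mathlib

noncomputable section

namespace NonautLin

variable {E : Type*} [NormedAddCommGroup E] [NormedSpace ℝ E]

/-- `N : E → ℝ` is a norm on the real vector space `E`. -/
def IsNormOn (N : E → ℝ) : Prop :=
  (∀ x, 0 ≤ N x) ∧ (∀ x, N x = 0 ↔ x = 0) ∧
  (∀ (c : ℝ) (x : E), N (c • x) = |c| * N x) ∧
  (∀ x y : E, N (x + y) ≤ N x + N y)

/-- Multiplication by the scalar `c` as a continuous linear equivalence
(junk value `id` for `c = 0`). -/
def smulCLE (c : ℝ) : E ≃L[ℝ] E :=
  if hc : c = 0 then ContinuousLinearEquiv.refl ℝ E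
  else
    { toFun := fun x => c • x
      invFun := fun x => c⁻¹ • x
      map_add' := fun x y => smul_add c x y
      map_smul' := fun a x => smul_comm c a x
      left_inv := fun x => by simp [smul_smul, inv_mul_cancel₀ hc]
      right_inv := fun x => by simp [smul_smul, mul_inv_cancel₀ hc]
      continuous_toFun := continuous_const_smul c
      continuous_invFun := continuous_const_smul c⁻¹ }

/-- The operator `c • A` as a continuous linear equivalence. -/
def scale (c : ℝ) (A : E ≃L[ℝ] E) : E ≃L[ℝ] E := A.trans (smulCLE c)

/-- `fwd A n k` is the composition `A (n+k-1) ∘ ⋯ ∘ A n`. -/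
def fwd (A : ℕ → (E ≃L[ℝ] E)) (n : ℕ) : ℕ → (E ≃L[ℝ] E)
  | 0 => ContinuousLinearEquiv.refl ℝ E
  | k + 1 => (fwd A n k).trans (A (n + k))

/-- The cocycle `𝒜(m,n)` associated with the one-sided sequence `A`:
`𝒜(m,n) = A (m-1) ∘ ⋯ ∘ A n` for `m > n`, `𝒜(n,n) = Id`, and
`𝒜(m,n) = (𝒜(n,m))⁻¹` for `m < n`. -/
def coc (A : ℕ → (E ≃L[ℝ] E)) (m n : ℕ) : E ≃L[ℝ] E :=
  if n ≤ m then fwd A n (m - n) else (fwd A m (n - m)).symm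

/-- Nonuniform strong polynomial dichotomy (indices `n ≥ 1`), with nonuniformity
exponent `eps`. -/
def NonuniformStrongPolyDichotomyWith (A : ℕ → (E ≃L[ℝ] E)) (eps : ℝ) : Prop :=
  ∃ K lam a : ℝ, 0 < K ∧ 0 < lam ∧ lam ≤ a ∧
    ∃ P : ℕ → (E →L[ℝ] E),
      (∀ n, 1 ≤ n → (P n).comp (P n) = P n) ∧
      (∀ n, 1 ≤ n → ((A n : E →L[ℝ] E)).comp (P n) = (P (n + 1)).comp (A n : E →L[ℝ] E)) ∧
      (∀ m n : ℕ, 1 ≤ n → n ≤ m →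
        ‖((coc A m n : E →L[ℝ] E)).comp (P n)‖ ≤ K * ((m : ℝ) / n) ^ (-lam) * (n : ℝ) ^ eps ∧
        ‖((coc A n m : E →L[ℝ] E)).comp (ContinuousLinearMap.id ℝ E - P m)‖
          ≤ K * ((m : ℝ) / n) ^ (-lam) * (m : ℝ) ^ eps ∧
        ‖(coc A m n : E →L[ℝ] E)‖ ≤ K * ((m : ℝ) / n) ^ a * (n : ℝ) ^ eps ∧
        ‖(coc A n m : E →L[ℝ] E)‖ ≤ K * ((m : ℝ) / n) ^ a * (m : ℝ) ^ eps)

/-- Nonuniform strong polynomial dichotomy (indices `n ≥ 1`). -/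
def NonuniformStrongPolyDichotomy (A : ℕ → (E ≃L[ℝ] E)) : Prop :=
  ∃ eps : ℝ, 0 ≤ eps ∧ NonuniformStrongPolyDichotomyWith A eps

/-- Strong polynomial dichotomy with respect to a sequence of norms (indices `n ≥ 1`). -/
def StrongPolyDichotomyWRT (A : ℕ → (E ≃L[ℝ] E)) (N : ℕ → E → ℝ) : Prop :=
  ∃ K lam a : ℝ, 0 < K ∧ 0 < lam ∧ lam ≤ a ∧
    ∃ P : ℕ → (E →L[ℝ] E),
      (∀ n, 1 ≤ n → (P n).comp (P n) = P n) ∧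
      (∀ n, 1 ≤ n → ((A n : E →L[ℝ] E)).comp (P n) = (P (n + 1)).comp (A n : E →L[ℝ] E)) ∧
      (∀ m n : ℕ, 1 ≤ n → n ≤ m → ∀ x : E,
        N m (coc A m n (P n x)) ≤ K * ((m : ℝ) / n) ^ (-lam) * N n x ∧
        N n (coc A n m (x - P m x)) ≤ K * ((m : ℝ) / n) ^ (-lam) * N m x ∧
        N m (coc A m n x) ≤ K * ((m : ℝ) / n) ^ a * N n x ∧
        N n (coc A n m x) ≤ K * ((m : ℝ) / n) ^ a * N m x)

/-- Strong exponential dichotomy, over `ℤ⁺`, with respect to a sequence of norms and a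
given sequence of projections. -/
def StrongExpDichotomyWRTProj (B : ℕ → (E ≃L[ℝ] E)) (N : ℕ → E → ℝ)
    (P : ℕ → (E →L[ℝ] E)) : Prop :=
  ∃ K lam a : ℝ, 0 < K ∧ 0 < lam ∧ lam ≤ a ∧
    (∀ n, (P n).comp (P n) = P n) ∧
    (∀ n, ((B n : E →L[ℝ] E)).comp (P n) = (P (n + 1)).comp (B n : E →L[ℝ] E)) ∧
    (∀ m n : ℕ, n ≤ m → ∀ x : E,
      N m (coc B m n (P n x)) ≤ K * Real.exp (-lam * ((m : ℝ) - n)) * N n x ∧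
      N n (coc B n m (x - P m x)) ≤ K * Real.exp (-lam * ((m : ℝ) - n)) * N m x ∧
      N m (coc B m n x) ≤ K * Real.exp (a * ((m : ℝ) - n)) * N n x ∧
      N n (coc B n m x) ≤ K * Real.exp (a * ((m : ℝ) - n)) * N m x)

/-- Strong exponential dichotomy, over `ℤ⁺`, with respect to a sequence of norms. -/
def StrongExpDichotomyWRT (B : ℕ → (E ≃L[ℝ] E)) (N : ℕ → E → ℝ) : Prop :=
  ∃ P : ℕ → (E →L[ℝ] E), StrongExpDichotomyWRTProj B N P

/-- The exponential dichotomy spectrum over `ℤ⁺`: the set of `τ > 0` such that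
`((1/τ) B_n)` does not admit a strong exponential dichotomy w.r.t. the norms `N`. -/
def SigmaED (B : ℕ → (E ≃L[ℝ] E)) (N : ℕ → E → ℝ) : Set ℝ :=
  {τ | 0 < τ ∧ ¬ StrongExpDichotomyWRT (fun n => scale τ⁻¹ (B n)) N}

/-- The polynomial dichotomy spectrum: the set of `τ ∈ ℝ` such that
`(((n+1)/n)^{-τ} A_n)` does not admit a strong polynomial dichotomy w.r.t. `N`. -/
def SigmaPD (A : ℕ → (E ≃L[ℝ] E)) (N : ℕ → E → ℝ) : Set ℝ :=
  {τ | ¬ StrongPolyDichotomyWRT (fun n => scale ((((n : ℝ) + 1) / n) ^ (-τ)) (A n)) N}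


/-! ### Closed spectra with a monotone index -/

/-- The part to the right of a resolvent point `s₀` of a spectrum whose complement `R` carries a
locally constant monotone index `f`, constant index values filling the gaps between them. -/
theorem exists_intervals_right {R : Set ℝ} {f : ℝ → ℕ} {d : ℕ} {T : ℝ} (hR : IsOpen R)
    (hmono : Monotone f) (hloc : ∀ s ∈ R, ∀ᶠ t in nhds s, f t = f s)
    (hfill : ∀ s ∈ R, ∀ t ∈ R, f s = f t → Set.Icc s t ⊆ R)
    (hT : ∀ t, T ≤ t → t ∈ R ∧ f t = d) (k : ℕ) :
    ∀ s₀ ∈ R, f s₀ ≤ d → d - f s₀ = k →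
      ∃ r : ℕ, r ≤ k ∧ (f s₀ < d → 1 ≤ r) ∧ ∃ α β : ℕ → ℝ,
        (∀ i, 1 ≤ i → i ≤ r → s₀ < α i ∧ α i ≤ β i) ∧
        (∀ i, 1 ≤ i → i < r → β i < α (i + 1)) ∧
        ∀ x, s₀ < x → (x ∉ R ↔ ∃ i, 1 ≤ i ∧ i ≤ r ∧ α i ≤ x ∧ x ≤ β i) := by
  induction k using Nat.strong_induction_on with
  | _ k ih =>
  intro s₀ hs₀ hle hk
  rcases hle.eq_or_lt with heq | hlt
  · refine ⟨0, Nat.zero_le _, fun h => by omega, fun _ => 0, fun _ => 0, fun i _ _ => by omega,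
      fun i _ _ => by omega, fun x hx => ?_⟩
    have hxR : x ∈ R := by
      obtain ⟨h1, h2⟩ := hT (max x T) (le_max_right _ _)
      exact hfill s₀ hs₀ _ h1 (heq.trans h2.symm) ⟨hx.le, le_max_left _ _⟩
    simp only [hxR, not_true_eq_false, false_iff]
    rintro ⟨i, h1, h2, -⟩
    omega
  have hsT : s₀ ≤ T := by
    by_contra h
    exact hlt.ne (hT s₀ (not_le.1 h).le).2
  have hC : (Rᶜ ∩ Set.Ici s₀).Nonempty := by
    by_contra hne
    have hsub : Set.Icc s₀ T ⊆ R := fun x hx => by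
      by_contra hxR
      exact hne ⟨x, hxR, hx.1⟩
    have hcont : ContinuousOn f (Set.Icc s₀ T) := fun x hx => by
      refine ContinuousAt.continuousWithinAt ?_
      exact (continuousAt_const (y := f x)).congr
        ((hloc x (hsub hx)).mono fun t ht => ht.symm)
    have := isPreconnected_Icc.constant hcont (Set.left_mem_Icc.2 hsT) (Set.right_mem_Icc.2 hsT)
    exact hlt.ne (this.trans (hT T le_rfl).2)
  have hbdd : BddBelow (Rᶜ ∩ Set.Ici s₀) := ⟨s₀, fun x hx => hx.2⟩
  obtain ⟨haR, has⟩ := (hR.isClosed_compl.inter isClosed_Ici).csInf_mem hC hbdd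
  set a := sInf (Rᶜ ∩ Set.Ici s₀) with ha
  have hsa : s₀ < a := lt_of_le_of_ne has fun h => haR (h ▸ hs₀)
  have hbelow : ∀ x, s₀ < x → x < a → x ∈ R := fun x h1 h2 => by
    by_contra hx
    exact absurd (csInf_le hbdd ⟨hx, h1.le⟩) (not_le.2 h2)
  have hS : ∃ j, ∃ t ∈ R, a < t ∧ f t = j :=
    ⟨_, max (a + 1) T, (hT _ (le_max_right _ _)).1,
      (lt_add_one a).trans_le (le_max_left _ _), rfl⟩
  classical
  obtain ⟨t₁, ht₁R, ht₁a, ht₁⟩ := Nat.find_spec hS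
  have hmin : ∀ t ∈ R, a < t → f t₁ ≤ f t := fun t h1 h2 =>
    ht₁ ▸ Nat.find_min' hS ⟨t, h1, h2, rfl⟩
  have hft₁ : f s₀ < f t₁ := by
    refine lt_of_le_of_ne (hmono (hsa.trans ht₁a).le) fun h => ?_
    exact haR (hfill s₀ hs₀ t₁ ht₁R h ⟨hsa.le, ht₁a.le⟩)
  have hft₁d : f t₁ ≤ d :=
    (hmono (le_max_left t₁ T)).trans (hT _ (le_max_right _ _)).2.le
  set U : Set ℝ := {t | t ∈ R ∧ a < t ∧ f t = f t₁} with hU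
  have hUne : U.Nonempty := ⟨t₁, ht₁R, ht₁a, rfl⟩
  have hUb : BddBelow U := ⟨a, fun x hx => hx.2.1.le⟩
  set b := sInf U with hb
  have hab : a ≤ b := le_csInf hUne fun x hx => hx.2.1.le
  have hUmem : ∀ x ∈ R, a < x → x ≤ t₁ → x ∈ U := fun x h1 h2 h3 =>
    ⟨h1, h2, le_antisymm (hmono h3) (hmin x h1 h2)⟩
  have hbt : b ≤ t₁ := csInf_le hUb ⟨ht₁R, ht₁a, rfl⟩
  have hbR : b ∉ R := by
    intro hbR
    have hab' : a < b := lt_of_le_of_ne hab fun h => haR (h ▸ hbR)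
    have hev : ∀ᶠ x in nhds b, x ∈ R ∧ a < x :=
      Filter.Eventually.and (hR.mem_nhds hbR) (lt_mem_nhds hab')
    obtain ⟨x, ⟨hxR, hxa⟩, hxb⟩ :=
      ((hev.filter_mono nhdsWithin_le_nhds).and
        (self_mem_nhdsWithin : Set.Iio b ∈ nhdsWithin b (Set.Iio b))).exists
    exact absurd (csInf_le hUb (hUmem x hxR hxa ((le_of_lt hxb).trans hbt))) (not_le.2 hxb)
  have hbt' : b < t₁ := lt_of_le_of_ne hbt fun h => hbR (h ▸ ht₁R)
  obtain ⟨r, hr, -, α, β, h1, h2, h3⟩ :=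
    ih (d - f t₁) (by omega) t₁ ht₁R hft₁d rfl
  refine ⟨r + 1, by omega, fun _ => by omega, fun i => if i = 1 then a else α (i - 1),
    fun i => if i = 1 then b else β (i - 1), ?_, ?_, ?_⟩
  · intro i hi hir
    by_cases h : i = 1
    · simp [h, hsa, hab]
    · obtain ⟨h4, h5⟩ := h1 (i - 1) (by omega) (by omega)
      simp only [h, if_false]
      exact ⟨(hsa.trans ht₁a).trans h4, h5⟩
  · intro i hi hir
    by_cases h : i = 1
    · subst h
      simpa using hbt'.trans (h1 1 le_rfl (by omega)).1
    · have h4 := h2 (i - 1) (by omega) (by omega)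
      have h5 : i - 1 + 1 = i := by omega
      have h6 : i ≠ 0 := by omega
      rw [h5] at h4
      simpa [h, h6] using h4
  · intro x hx
    constructor
    · intro hxR
      rcases le_or_gt x b with hxb | hxb
      · exact ⟨1, le_rfl, by omega, by simpa using not_lt.1 fun h => hxR (hbelow x hx h),
          by simpa using hxb⟩
      · have hxt : t₁ < x := by
          by_contra h
          obtain ⟨u, hu, hux⟩ := exists_lt_of_csInf_lt hUne hxb
          exact hxR (hfill u hu.1 t₁ ht₁R hu.2.2 ⟨hux.le, not_lt.1 h⟩)
        obtain ⟨i, h4, h5, h6⟩ := (h3 x hxt).1 hxR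
        have h7 : i ≠ 0 := by omega
        exact ⟨i + 1, by omega, by omega, by simpa [h7] using h6⟩
    · rintro ⟨i, h4, h5, h6, h7⟩
      by_cases h : i = 1
      · simp only [h, if_true] at h6 h7
        intro hxR
        have hax : a < x := lt_of_le_of_ne h6 fun h => haR (h ▸ hxR)
        have : x = b := le_antisymm h7 (csInf_le hUb (hUmem x hxR hax (h7.trans hbt)))
        exact hbR (this ▸ hxR)
      · simp only [h, if_false] at h6 h7
        obtain ⟨h8, -⟩ := h1 (i - 1) (by omega) (by omega)
        exact (h3 x (h8.trans_le h6)).2 ⟨i - 1, by omega, by omega, h6, h7⟩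

/-! ### Dichotomies of a sequence of norms -/

theorem IsNormOn.map_zero {L : E → ℝ} (h : IsNormOn L) : L 0 = 0 := (h.2.1 0).2 rfl

/-- A sequence of norms `M n`, `n ≥ b`, is split by a projection into vectors growing slower, and
vectors growing faster, than `exp (s * θ n)`. -/
def NormDichotomyWith (b : ℕ) (θ : ℕ → ℝ) (M : ℕ → E → ℝ) (s : ℝ) (P : E →L[ℝ] E)
    (K lam : ℝ) : Prop :=
  0 < K ∧ 0 < lam ∧ P.comp P = P ∧ ∀ m n : ℕ, b ≤ n → n ≤ m → ∀ y : E,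
    M m (P y) ≤ K * Real.exp ((s - lam) * (θ m - θ n)) * M n y ∧
    M n (y - P y) ≤ K * Real.exp ((-s - lam) * (θ m - θ n)) * M m y

/-- Existence of a splitting as in `NormDichotomyWith`. -/
def NormDichotomy (b : ℕ) (θ : ℕ → ℝ) (M : ℕ → E → ℝ) (s : ℝ) : Prop :=
  ∃ P K lam, NormDichotomyWith b θ M s P K lam

/-- The subspace of vectors growing at most like `exp (s * n)`. -/
def slowSubspace (L : ℕ → E → ℝ) (hL : ∀ n, IsNormOn (L n)) (s : ℝ) : Submodule ℝ E where
  carrier := {y | ∃ C : ℝ, ∀ n : ℕ, L n y ≤ C * Real.exp (s * n)}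
  zero_mem' := ⟨0, fun n => by simp [(hL n).map_zero]⟩
  add_mem' := by
    rintro x y ⟨C, hC⟩ ⟨D, hD⟩
    refine ⟨C + D, fun n => ((hL n).2.2.2 x y).trans ?_⟩
    linarith [hC n, hD n]
  smul_mem' := by
    rintro c x ⟨C, hC⟩
    refine ⟨|c| * C, fun n => ?_⟩
    rw [(hL n).2.2.1, mul_assoc]
    exact mul_le_mul_of_nonneg_left (hC n) (abs_nonneg c)

theorem slowSubspace_mono (L : ℕ → E → ℝ) (hL : ∀ n, IsNormOn (L n)) :
    Monotone (slowSubspace L hL) := by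
  rintro s t hst y ⟨C, hC⟩
  refine ⟨|C|, fun n => (hC n).trans ?_⟩
  have : s * n ≤ t * n := mul_le_mul_of_nonneg_right hst n.cast_nonneg
  exact mul_le_mul (le_abs_self C) (Real.exp_le_exp.2 this) (Real.exp_pos _).le (abs_nonneg C)

theorem NormDichotomyWith.mem_slowSubspace_iff {L : ℕ → E → ℝ} (hL : ∀ n, IsNormOn (L n))
    {s : ℝ} {P : E →L[ℝ] E} {K lam : ℝ}
    (h : NormDichotomyWith 0 (fun n => (n : ℝ)) L s P K lam) (y : E) :
    y ∈ slowSubspace L hL s ↔ P y = y := by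
  obtain ⟨hK, hlam, -, hd⟩ := h
  constructor
  · rintro ⟨C, hC⟩
    have hbound : ∀ m : ℕ, L 0 (y - P y) ≤ K * C * Real.exp (-lam) ^ m := fun m => by
      have h1 := (hd m 0 le_rfl (Nat.zero_le m) y).2
      have h2 := mul_le_mul_of_nonneg_left (hC m)
        (mul_pos hK (Real.exp_pos ((-s - lam) * ((m : ℝ) - (0 : ℕ))))).le
      refine (h1.trans h2).trans_eq ?_
      rw [← Real.exp_nat_mul, mul_mul_mul_comm, ← Real.exp_add]
      congr 2
      push_cast
      ring
    have hlim : Filter.Tendsto (fun m : ℕ => K * C * Real.exp (-lam) ^ m) Filter.atTop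
        (nhds (K * C * 0)) :=
      (tendsto_pow_atTop_nhds_zero_of_lt_one (Real.exp_pos _).le
        (Real.exp_lt_one_iff.2 (by linarith))).const_mul _
    have h0 := ge_of_tendsto' hlim hbound
    rw [mul_zero] at h0
    have := ((hL 0).2.1 _).1 (le_antisymm h0 ((hL 0).1 _))
    exact (sub_eq_zero.1 this).symm
  · intro hy
    refine ⟨K * L 0 y, fun n => ?_⟩
    have h1 := (hd n 0 le_rfl (Nat.zero_le n) y).1
    rw [hy] at h1
    have h2 : Real.exp ((s - lam) * ((n : ℝ) - (0 : ℕ))) ≤ Real.exp (s * n) := by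
      refine Real.exp_le_exp.2 ?_
      push_cast
      nlinarith [(n.cast_nonneg : (0 : ℝ) ≤ n)]
    have h3 := mul_le_mul_of_nonneg_left h2 (mul_nonneg hK.le ((hL 0).1 y))
    linarith

theorem NormDichotomyWith.perturb {b : ℕ} {θ : ℕ → ℝ} (hθ : ∀ m n, b ≤ n → n ≤ m → θ n ≤ θ m)
    {L : ℕ → E → ℝ} (hL : ∀ n, b ≤ n → IsNormOn (L n)) {s t : ℝ} {P : E →L[ℝ] E} {K lam : ℝ}
    (h : NormDichotomyWith b θ L s P K lam) (ht : |t - s| < lam) :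
    NormDichotomyWith b θ L t P K (lam - |t - s|) := by
  obtain ⟨hK, hlam, hP, hd⟩ := h
  refine ⟨hK, by linarith, hP, fun m n hb hnm y => ?_⟩
  obtain ⟨h1, h2⟩ := hd m n hb hnm y
  have hle := sub_nonneg.2 (hθ m n hb hnm)
  have h3 := le_abs_self (t - s)
  have h4 := neg_abs_le (t - s)
  refine ⟨h1.trans ?_, h2.trans ?_⟩
  · refine mul_le_mul_of_nonneg_right (mul_le_mul_of_nonneg_left (Real.exp_le_exp.2 ?_) hK.le)
      ((hL n hb).1 _)
    exact mul_le_mul_of_nonneg_right (by linarith) hle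
  · refine mul_le_mul_of_nonneg_right (mul_le_mul_of_nonneg_left (Real.exp_le_exp.2 ?_) hK.le)
      ((hL m (hb.trans hnm)).1 _)
    exact mul_le_mul_of_nonneg_right (by linarith) hle

theorem NormDichotomy.of_slowSubspace_eq {L : ℕ → E → ℝ} (hL : ∀ n, IsNormOn (L n))
    {s t u : ℝ} (hs : NormDichotomy 0 (fun n => (n : ℝ)) L s)
    (ht : NormDichotomy 0 (fun n => (n : ℝ)) L t)
    (hst : slowSubspace L hL s = slowSubspace L hL t) (hsu : s ≤ u) (hut : u ≤ t) :
    NormDichotomy 0 (fun n => (n : ℝ)) L u := by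
  obtain ⟨P, K, lam, hP⟩ := hs
  obtain ⟨Q, K', lam', hQ⟩ := ht
  have hPQ : ∀ y, P (Q y) = Q y := fun y => by
    rw [← hP.mem_slowSubspace_iff hL, hst, hQ.mem_slowSubspace_iff hL]
    exact congrArg (fun F : E →L[ℝ] E => F y) hQ.2.2.1
  obtain ⟨hK, hlam, -, hd⟩ := hP
  obtain ⟨hK', hlam', hQQ, hd'⟩ := hQ
  refine ⟨Q, K * K' + K', min lam lam', by positivity, lt_min hlam hlam', hQQ,
    fun m n hb hnm y => ?_⟩
  have hnm' : (0 : ℝ) ≤ (m : ℝ) - n := sub_nonneg.2 (by exact_mod_cast hnm)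
  have hl := min_le_left lam lam'
  have hl' := min_le_right lam lam'
  constructor
  · have h1 := (hd m n hb hnm (Q y)).1
    rw [hPQ] at h1
    have h2 := (hd' n n hb le_rfl y).1
    simp only [sub_self, mul_zero, Real.exp_zero, mul_one] at h2
    have h3 : Real.exp ((s - lam) * ((m : ℝ) - n)) ≤
        Real.exp ((u - min lam lam') * ((m : ℝ) - n)) :=
      Real.exp_le_exp.2 (mul_le_mul_of_nonneg_right (by linarith) hnm')
    calc L m (Q y) ≤ K * Real.exp ((s - lam) * ((m : ℝ) - n)) * L n (Q y) := h1
      _ ≤ K * Real.exp ((u - min lam lam') * ((m : ℝ) - n)) * (K' * L n y) := by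
          have := (hL n).1 (Q y)
          gcongr
      _ = K * K' * Real.exp ((u - min lam lam') * ((m : ℝ) - n)) * L n y := by ring
      _ ≤ _ := by
          have := (hL n).1 y
          gcongr
          linarith
  · have h1 := (hd' m n hb hnm y).2
    refine h1.trans ?_
    have := (hL m).1 y
    have h3 : Real.exp ((-t - lam') * ((m : ℝ) - n)) ≤
        Real.exp ((-u - min lam lam') * ((m : ℝ) - n)) :=
      Real.exp_le_exp.2 (mul_le_mul_of_nonneg_right (by linarith) hnm')
    gcongr
    nlinarith

/-- The exponents at which a sequence of norms of bounded growth has no dichotomy form a nonempty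
union of at most `finrank ℝ E` disjoint compact intervals. -/
theorem exists_intervals_not_normDichotomy [FiniteDimensional ℝ E]
    (hE : 1 ≤ Module.finrank ℝ E) {L : ℕ → E → ℝ}
    (hL : ∀ n, IsNormOn (L n)) {K a : ℝ} (hK : 0 < K)
    (hg : ∀ m n : ℕ, n ≤ m → ∀ y, L m y ≤ K * Real.exp (a * ((m : ℝ) - n)) * L n y ∧
      L n y ≤ K * Real.exp (a * ((m : ℝ) - n)) * L m y) :
    ∃ r : ℕ, 1 ≤ r ∧ r ≤ Module.finrank ℝ E ∧ ∃ α β : ℕ → ℝ,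
      (∀ i, 1 ≤ i → i ≤ r → α i ≤ β i) ∧ (∀ i, 1 ≤ i → i < r → β i < α (i + 1)) ∧
      ∀ x, ¬ NormDichotomy 0 (fun n => (n : ℝ)) L x ↔
        ∃ i, 1 ≤ i ∧ i ≤ r ∧ α i ≤ x ∧ x ≤ β i := by
  have hθ : ∀ m n : ℕ, 0 ≤ n → n ≤ m → (n : ℝ) ≤ m := fun m n _ h => by exact_mod_cast h
  set R : Set ℝ := {s | NormDichotomy 0 (fun n => (n : ℝ)) L s} with hRdef
  set f : ℝ → ℕ := fun s => Module.finrank ℝ (slowSubspace L hL s) with hf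
  have hnear : ∀ s ∈ R, ∀ᶠ t in nhds s, t ∈ R ∧ f t = f s := by
    rintro s ⟨P, C, lam, h⟩
    have hball : ∀ᶠ t in nhds s, |t - s| < lam := Metric.ball_mem_nhds s h.2.1
    refine hball.mono fun t ht => ?_
    have h' := h.perturb hθ (fun n _ => hL n) ht
    refine ⟨⟨P, C, _, h'⟩, ?_⟩
    have : slowSubspace L hL t = slowSubspace L hL s := by
      ext y
      rw [h.mem_slowSubspace_iff hL, h'.mem_slowSubspace_iff hL]
    exact congrArg (fun F : Submodule ℝ E => Module.finrank ℝ F) this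
  have hlow : ∀ s, s ≤ -a - 1 → s ∈ R ∧ f s = 0 := by
    intro s hs
    have h : NormDichotomyWith 0 (fun n => (n : ℝ)) L s 0 K 1 := by
      refine ⟨hK, one_pos, by simp, fun m n _ hnm y => ?_⟩
      have hle := sub_nonneg.2 (hθ m n (Nat.zero_le _) hnm)
      refine ⟨?_, ?_⟩
      · rw [zero_apply, (hL m).map_zero]
        have := (hL n).1 y
        positivity
      · rw [zero_apply, sub_zero]
        refine (hg m n hnm y).2.trans ?_
        have := (hL m).1 y
        gcongr
        linarith
    refine ⟨⟨_, _, _, h⟩, ?_⟩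
    have : slowSubspace L hL s = ⊥ := by
      ext y
      rw [h.mem_slowSubspace_iff hL, Submodule.mem_bot, zero_apply, eq_comm]
    exact (congrArg (fun F : Submodule ℝ E => Module.finrank ℝ F) this).trans (finrank_bot ℝ E)
  have hhigh : ∀ s, a + 1 ≤ s → s ∈ R ∧ f s = Module.finrank ℝ E := by
    intro s hs
    have h : NormDichotomyWith 0 (fun n => (n : ℝ)) L s (ContinuousLinearMap.id ℝ E) K 1 := by
      refine ⟨hK, one_pos, by simp, fun m n _ hnm y => ?_⟩
      have hle := sub_nonneg.2 (hθ m n (Nat.zero_le _) hnm)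
      refine ⟨?_, ?_⟩
      · rw [ContinuousLinearMap.id_apply]
        refine (hg m n hnm y).1.trans ?_
        have := (hL n).1 y
        gcongr
        linarith
      · rw [ContinuousLinearMap.id_apply, sub_self, (hL n).map_zero]
        have := (hL m).1 y
        positivity
    refine ⟨⟨_, _, _, h⟩, ?_⟩
    have : slowSubspace L hL s = ⊤ := by
      ext y
      rw [h.mem_slowSubspace_iff hL]
      simp
    exact (congrArg (fun F : Submodule ℝ E => Module.finrank ℝ F) this).trans (finrank_top ℝ E)
  have hR : IsOpen R := isOpen_iff_mem_nhds.2 fun s hs => (hnear s hs).mono fun t ht => ht.1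
  have hmono : Monotone f := fun s t hst =>
    Submodule.finrank_mono (slowSubspace_mono L hL hst)
  have hfill : ∀ s ∈ R, ∀ t ∈ R, f s = f t → Set.Icc s t ⊆ R := by
    intro s hs t ht hst u hu
    exact NormDichotomy.of_slowSubspace_eq hL hs ht (Submodule.eq_of_le_of_finrank_eq
      (slowSubspace_mono L hL (hu.1.trans hu.2)) hst) hu.1 hu.2
  obtain ⟨h0, h0'⟩ := hlow _ le_rfl
  obtain ⟨r, h1, h2, α, β, h3, h4, h5⟩ := exists_intervals_right hR hmono
    (fun s hs => (hnear s hs).mono fun t ht => ht.2) hfill hhigh _ (-a - 1) h0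
    (by omega) rfl
  refine ⟨r, h2 (by omega), by omega, α, β, fun i hi hir => (h3 i hi hir).2, h4, fun x => ?_⟩
  rcases lt_or_ge (-a - 1) x with hx | hx
  · exact h5 x hx
  · simp only [show NormDichotomy 0 (fun n => (n : ℝ)) L x from (hlow x hx).1,
      not_true_eq_false, false_iff]
    rintro ⟨i, hi, hir, h6, -⟩
    linarith [(h3 i hi hir).1]

/-- Passing to the times `2 ^ n` turns the scale `log` into the linear one. -/
theorem normDichotomy_log_iff {M : ℕ → E → ℝ} (hM : ∀ n, 1 ≤ n → IsNormOn (M n))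
    {K a : ℝ} (hK : 0 < K) (ha : 0 < a)
    (hg : ∀ m n : ℕ, 1 ≤ n → n ≤ m → ∀ y,
      M m y ≤ K * Real.exp (a * (Real.log m - Real.log n)) * M n y ∧
      M n y ≤ K * Real.exp (a * (Real.log m - Real.log n)) * M m y) (s : ℝ) :
    NormDichotomy 1 (fun n => Real.log n) M s ↔
      NormDichotomy 0 (fun n => (n : ℝ)) (fun n => M (2 ^ n)) (s * Real.log 2) := by
  have hlog : 0 < Real.log 2 := Real.log_pos one_lt_two
  constructor
  · rintro ⟨P, C, lam, hC, hlam, hP, hd⟩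
    refine ⟨P, C, lam * Real.log 2, hC, by positivity, hP, fun m n _ hnm y => ?_⟩
    have h := hd (2 ^ m) (2 ^ n) Nat.one_le_two_pow (Nat.pow_le_pow_right two_pos hnm) y
    push_cast at h
    rw [Real.log_pow, Real.log_pow] at h
    convert h using 4 <;> ring_nf
  · rintro ⟨P, C, lam, hC, hlam, hP, hd⟩
    set μ := lam / Real.log 2 with hμ
    have hμlam : lam = μ * Real.log 2 := by rw [hμ]; field_simp
    have hdist : ∀ n : ℕ, 1 ≤ n → 2 ^ Nat.log 2 n ≤ n ∧
        0 ≤ Real.log n - Nat.log 2 n * Real.log 2 ∧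
        Real.log n - Nat.log 2 n * Real.log 2 ≤ Real.log 2 := by
      intro n hn
      have h1 : 2 ^ Nat.log 2 n ≤ n := Nat.pow_log_le_self 2 (by omega)
      have h2 : n ≤ 2 ^ (Nat.log 2 n + 1) := (Nat.lt_pow_succ_log_self one_lt_two n).le
      have h1' := Real.log_le_log (by positivity)
        (show (2 : ℝ) ^ Nat.log 2 n ≤ n by exact_mod_cast h1)
      have h2' := Real.log_le_log (by exact_mod_cast hn)
        (show (n : ℝ) ≤ (2 : ℝ) ^ (Nat.log 2 n + 1) by exact_mod_cast h2)
      rw [Real.log_pow] at h1' h2'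
      push_cast at h2'
      exact ⟨h1, by linarith, by linarith⟩
    have hnb : ∀ n : ℕ, 1 ≤ n → ∀ y,
        M n y ≤ K * Real.exp (a * Real.log 2) * M (2 ^ Nat.log 2 n) y ∧
        M (2 ^ Nat.log 2 n) y ≤ K * Real.exp (a * Real.log 2) * M n y := by
      intro n hn y
      obtain ⟨h1, h2, h3⟩ := hdist n hn
      have h4 := hg n (2 ^ Nat.log 2 n) Nat.one_le_two_pow h1 y
      push_cast at h4
      rw [Real.log_pow] at h4
      have h5 : Real.exp (a * (Real.log n - Nat.log 2 n * Real.log 2)) ≤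
          Real.exp (a * Real.log 2) :=
        Real.exp_le_exp.2 (mul_le_mul_of_nonneg_left h3 ha.le)
      have h6 := (hM n hn).1 y
      have h7 := (hM (2 ^ Nat.log 2 n) Nat.one_le_two_pow).1 y
      exact ⟨h4.1.trans (by gcongr), h4.2.trans (by gcongr)⟩
    set D := K * Real.exp (a * Real.log 2) with hD
    have hDpos : 0 < D := by positivity
    have hexp : ∀ (c : ℝ) (m n : ℕ), 1 ≤ n → 1 ≤ m →
        Real.exp (c * Real.log 2 * ((Nat.log 2 m : ℝ) - Nat.log 2 n)) ≤
          Real.exp (|c| * Real.log 2) * Real.exp (c * (Real.log m - Real.log n)) := by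
      intro c m n hn hm
      rw [← Real.exp_add]
      refine Real.exp_le_exp.2 ?_
      obtain ⟨-, h1, h2⟩ := hdist n hn
      obtain ⟨-, h3, h4⟩ := hdist m hm
      set x := (Nat.log 2 m : ℝ) * Real.log 2 - Nat.log 2 n * Real.log 2 -
        (Real.log m - Real.log n) with hx
      have h5 : |x| ≤ Real.log 2 := abs_le.2 ⟨by linarith, by linarith⟩
      have h6 : c * x ≤ |c| * Real.log 2 := (le_abs_self _).trans
        ((abs_mul c x).trans_le (mul_le_mul_of_nonneg_left h5 (abs_nonneg c)))
      rw [hx] at h6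
      linarith
    refine ⟨P, D * D * C * Real.exp (|s - μ| * Real.log 2) +
      D * D * C * Real.exp (|-s - μ| * Real.log 2), μ, by positivity, by positivity, hP,
      fun m n hn hnm y => ?_⟩
    have hm : 1 ≤ m := hn.trans hnm
    obtain ⟨h1, h2⟩ := hd (Nat.log 2 m) (Nat.log 2 n) (Nat.zero_le _)
      (Nat.log_mono_right hnm) y
    rw [hμlam, show s * Real.log 2 - μ * Real.log 2 = (s - μ) * Real.log 2 by ring] at h1
    rw [hμlam, show -(s * Real.log 2) - μ * Real.log 2 = (-s - μ) * Real.log 2 by ring] at h2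
    have hn0 := (hM n hn).1 y
    have hm0 := (hM m hm).1 y
    have hn1 := (hM (2 ^ Nat.log 2 n) Nat.one_le_two_pow).1 y
    have hm1 := (hM (2 ^ Nat.log 2 m) Nat.one_le_two_pow).1 y
    constructor
    · calc M m (P y) ≤ D * M (2 ^ Nat.log 2 m) (P y) := (hnb m hm _).1
        _ ≤ D * (C * (Real.exp (|s - μ| * Real.log 2) *
              Real.exp ((s - μ) * (Real.log m - Real.log n))) * (D * M n y)) := by
            refine mul_le_mul_of_nonneg_left (h1.trans ?_) hDpos.le
            have := hexp (s - μ) m n hn hm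
            have := (hnb n hn y).2
            gcongr
        _ = D * D * C * Real.exp (|s - μ| * Real.log 2) *
              Real.exp ((s - μ) * (Real.log m - Real.log n)) * M n y := by ring
        _ ≤ _ := by
            gcongr
            exact le_add_of_nonneg_right (by positivity)
    · calc M n (y - P y) ≤ D * M (2 ^ Nat.log 2 n) (y - P y) := (hnb n hn _).1
        _ ≤ D * (C * (Real.exp (|-s - μ| * Real.log 2) *
              Real.exp ((-s - μ) * (Real.log m - Real.log n))) * (D * M m y)) := by
            refine mul_le_mul_of_nonneg_left (h2.trans ?_) hDpos.le
            have := hexp (-s - μ) m n hn hm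
            have := (hnb m hm y).2
            gcongr
        _ = D * D * C * Real.exp (|-s - μ| * Real.log 2) *
              Real.exp ((-s - μ) * (Real.log m - Real.log n)) * M m y := by ring
        _ ≤ _ := by
            gcongr
            exact le_add_of_nonneg_left (by positivity)

/-! ### Cocycles -/

theorem scale_apply {c : ℝ} (hc : c ≠ 0) (A : E ≃L[ℝ] E) (x : E) : scale c A x = c • A x := by
  unfold scale smulCLE
  rw [dif_neg hc]
  rfl

theorem fwd_add (A : ℕ → (E ≃L[ℝ] E)) (n j k : ℕ) (x : E) :
    fwd A n (j + k) x = fwd A (n + j) k (fwd A n j x) := by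
  induction k with
  | zero => rfl
  | succ k ih =>
    change A (n + (j + k)) (fwd A n (j + k) x) = A (n + j + k) (fwd A (n + j) k (fwd A n j x))
    rw [ih, add_assoc]

theorem coc_self (A : ℕ → (E ≃L[ℝ] E)) (n : ℕ) (x : E) : coc A n n x = x := by
  simp [coc, fwd]

theorem coc_succ (A : ℕ → (E ≃L[ℝ] E)) {b n : ℕ} (h : b ≤ n) (x : E) :
    coc A (n + 1) b x = A n (coc A n b x) := by
  rw [coc, coc, if_pos h, if_pos (h.trans n.le_succ), Nat.succ_sub h]
  change A (b + (n - b)) _ = _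
  rw [Nat.add_sub_cancel' h]
  rfl

theorem coc_coc_of_le (A : ℕ → (E ≃L[ℝ] E)) {b n m : ℕ} (hb : b ≤ n) (hn : n ≤ m) (x : E) :
    coc A m n (coc A n b x) = coc A m b x := by
  rw [coc, coc, coc, if_pos hb, if_pos hn, if_pos (hb.trans hn),
    show m - b = (n - b) + (m - n) by omega, fwd_add, Nat.add_sub_cancel' hb]

theorem coc_coc (A : ℕ → (E ≃L[ℝ] E)) {b n m : ℕ} (hn : b ≤ n) (hm : b ≤ m) (x : E) :
    coc A m n (coc A n b x) = coc A m b x := by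
  rcases le_total n m with h | h
  · exact coc_coc_of_le A hn h x
  rcases h.eq_or_lt with rfl | h'
  · exact coc_self A _ _
  have h1 : coc A m n = (coc A n m).symm := by
    rw [coc, coc, if_neg (not_le.2 h'), if_pos h]
  rw [h1, ContinuousLinearEquiv.symm_apply_eq, coc_coc_of_le A hm h]

theorem coc_scale {A : ℕ → (E ≃L[ℝ] E)} {b : ℕ} {c θ : ℕ → ℝ} {s : ℝ}
    (hc : ∀ n, b ≤ n → c n = Real.exp (-s * (θ (n + 1) - θ n))) {n : ℕ} (hn : b ≤ n) (x : E) :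
    coc (fun n => scale (c n) (A n)) n b x = Real.exp (-s * (θ n - θ b)) • coc A n b x := by
  induction n, hn using Nat.le_induction with
  | base => simp [coc_self]
  | succ n hn ih =>
    rw [coc_succ _ hn, coc_succ _ hn, ih, hc n hn, scale_apply (Real.exp_pos _).ne',
      map_smul, smul_smul, ← Real.exp_add]
    congr 2
    ring

theorem coc_scale_coc {A : ℕ → (E ≃L[ℝ] E)} {b : ℕ} {c θ : ℕ → ℝ} {s : ℝ}
    (hc : ∀ n, b ≤ n → c n = Real.exp (-s * (θ (n + 1) - θ n))) {m n : ℕ} (hm : b ≤ m)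
    (hn : b ≤ n) (x : E) :
    coc (fun n => scale (c n) (A n)) m n (coc A n b x) =
      Real.exp (-s * (θ m - θ n)) • coc A m b x := by
  have h : coc A n b x = coc (fun n => scale (c n) (A n)) n b
      (Real.exp (s * (θ n - θ b)) • x) := by
    rw [coc_scale hc hn, map_smul, smul_smul, ← Real.exp_add, ← add_mul, neg_add_cancel,
      zero_mul, Real.exp_zero, one_smul]
  rw [h, coc_coc _ hn hm, coc_scale hc hm, map_smul, smul_smul, ← Real.exp_add]
  congr 2
  ring

/-! ### Dichotomies of cocycles and of the pulled back norms -/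

/-- Strong dichotomy of a cocycle with respect to norms, at the time scale `θ` and from time
`b` on. -/
def StrongDichotomy (b : ℕ) (θ : ℕ → ℝ) (A : ℕ → (E ≃L[ℝ] E)) (N : ℕ → E → ℝ) : Prop :=
  ∃ K lam a : ℝ, 0 < K ∧ 0 < lam ∧ lam ≤ a ∧
    ∃ P : ℕ → (E →L[ℝ] E),
      (∀ n, b ≤ n → (P n).comp (P n) = P n) ∧
      (∀ n, b ≤ n → ((A n : E →L[ℝ] E)).comp (P n) = (P (n + 1)).comp (A n : E →L[ℝ] E)) ∧
      (∀ m n : ℕ, b ≤ n → n ≤ m → ∀ x : E,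
        N m (coc A m n (P n x)) ≤ K * Real.exp (-lam * (θ m - θ n)) * N n x ∧
        N n (coc A n m (x - P m x)) ≤ K * Real.exp (-lam * (θ m - θ n)) * N m x ∧
        N m (coc A m n x) ≤ K * Real.exp (a * (θ m - θ n)) * N n x ∧
        N n (coc A n m x) ≤ K * Real.exp (a * (θ m - θ n)) * N m x)

theorem strongPolyDichotomyWRT_iff (A : ℕ → (E ≃L[ℝ] E)) (N : ℕ → E → ℝ) :
    StrongPolyDichotomyWRT A N ↔ StrongDichotomy 1 (fun n => Real.log n) A N := by
  have key : ∀ (c : ℝ) (m n : ℕ), 1 ≤ n → n ≤ m →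
      ((m : ℝ) / n) ^ c = Real.exp (c * (Real.log m - Real.log n)) := by
    intro c m n hn hnm
    have hn' : (0 : ℝ) < n := by exact_mod_cast hn
    have hm' : (0 : ℝ) < m := by exact_mod_cast hn.trans hnm
    rw [Real.rpow_def_of_pos (div_pos hm' hn'), Real.log_div hm'.ne' hn'.ne', mul_comm]
  unfold StrongPolyDichotomyWRT StrongDichotomy
  refine exists_congr fun K => exists_congr fun lam => exists_congr fun a =>
    and_congr_right fun _ => and_congr_right fun _ => and_congr_right fun _ =>
    exists_congr fun P => and_congr_right fun _ => and_congr_right fun _ =>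
    forall_congr' fun m => forall_congr' fun n => forall_congr' fun hn =>
    forall_congr' fun hnm => ?_
  rw [key _ m n hn hnm, key _ m n hn hnm]

theorem strongExpDichotomyWRT_iff (A : ℕ → (E ≃L[ℝ] E)) (N : ℕ → E → ℝ) :
    StrongExpDichotomyWRT A N ↔ StrongDichotomy 0 (fun n => (n : ℝ)) A N := by
  constructor
  · rintro ⟨P, K, lam, a, h1, h2, h3, h4, h5, h6⟩
    exact ⟨K, lam, a, h1, h2, h3, P, fun n _ => h4 n, fun n _ => h5 n, fun m n _ => h6 m n⟩
  · rintro ⟨K, lam, a, h1, h2, h3, P, h4, h5, h6⟩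
    exact ⟨P, K, lam, a, h1, h2, h3, fun n => h4 n n.zero_le, fun n => h5 n n.zero_le,
      fun m n => h6 m n n.zero_le⟩

theorem IsNormOn.comp_equiv {L : E → ℝ} (h : IsNormOn L) (e : E ≃L[ℝ] E) :
    IsNormOn fun y => L (e y) := by
  refine ⟨fun x => h.1 _, fun x => ?_, fun c x => ?_, fun x y => ?_⟩
  · rw [h.2.1, map_eq_zero_iff e e.injective]
  · simp only [map_smul, h.2.2.1]
  · simp only [map_add]
    exact h.2.2.2 _ _

theorem coc_comm {A : ℕ → (E ≃L[ℝ] E)} {b : ℕ} {P : ℕ → (E →L[ℝ] E)}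
    (h : ∀ n, b ≤ n → ((A n : E →L[ℝ] E)).comp (P n) = (P (n + 1)).comp (A n : E →L[ℝ] E))
    {n : ℕ} (hn : b ≤ n) (y : E) : coc A n b (P b y) = P n (coc A n b y) := by
  induction n, hn using Nat.le_induction with
  | base => simp [coc_self]
  | succ n hn ih =>
    rw [coc_succ _ hn, coc_succ _ hn, ih]
    exact congrArg (fun F : E →L[ℝ] E => F (coc A n b y)) (h n hn)

/-- A rescaled cocycle of bounded growth has a strong dichotomy iff the pulled back norms are
split at the corresponding exponent. -/
theorem strongDichotomy_scale_iff {b : ℕ} {θ : ℕ → ℝ}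
    (hθ : ∀ m n, b ≤ n → n ≤ m → θ n ≤ θ m) {A : ℕ → (E ≃L[ℝ] E)} {N : ℕ → E → ℝ}
    (hN : ∀ n, b ≤ n → IsNormOn (N n)) {K₀ a₀ : ℝ} (hK₀ : 0 < K₀)
    (hg : ∀ m n : ℕ, b ≤ n → n ≤ m → ∀ y,
      N m (coc A m b y) ≤ K₀ * Real.exp (a₀ * (θ m - θ n)) * N n (coc A n b y) ∧
      N n (coc A n b y) ≤ K₀ * Real.exp (a₀ * (θ m - θ n)) * N m (coc A m b y))
    {c : ℕ → ℝ} {s : ℝ} (hc : ∀ n, b ≤ n → c n = Real.exp (-s * (θ (n + 1) - θ n))) :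
    StrongDichotomy b θ (fun n => scale (c n) (A n)) N ↔
      NormDichotomy b θ (fun n y => N n (coc A n b y)) s := by
  have hsurj : ∀ n x, ∃ y, coc A n b y = x := fun n x => (coc A n b).surjective x
  have hN' : ∀ n, b ≤ n → ∀ (r : ℝ) (y : E),
      N n (Real.exp r • y) = Real.exp r * N n y := fun n hn r y => by
    rw [(hN n hn).2.2.1, abs_of_pos (Real.exp_pos r)]
  constructor
  · rintro ⟨K, lam, a, hK, hlam, -, P, hP, hcomm, hd⟩
    have hcomm' : ∀ n, b ≤ n → ∀ y, coc A n b (P b y) = P n (coc A n b y) := by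
      intro n hn y
      have h := coc_comm hcomm hn y
      rw [coc_scale hc hn, coc_scale hc hn, map_smul] at h
      exact smul_right_injective E (Real.exp_pos _).ne' h
    refine ⟨P b, K, lam, hK, hlam, hP b le_rfl, fun m n hn hnm y => ?_⟩
    have hm := hn.trans hnm
    have h1 := (hd m n hn hnm (coc A n b y)).1
    have h2 := (hd m n hn hnm (coc A m b y)).2.1
    rw [← hcomm' n hn, coc_scale_coc hc hm hn, hN' m hm] at h1
    rw [← hcomm' m hm, ← map_sub, coc_scale_coc hc hn hm, hN' n hn] at h2
    constructor
    · have h3 := mul_le_mul_of_nonneg_left h1 (Real.exp_pos (s * (θ m - θ n))).le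
      rw [← mul_assoc, ← Real.exp_add, ← add_mul, add_neg_cancel, zero_mul, Real.exp_zero,
        one_mul] at h3
      refine h3.trans_eq ?_
      rw [sub_eq_add_neg s lam, add_mul, Real.exp_add]
      ring
    · have h3 := mul_le_mul_of_nonneg_left h2 (Real.exp_pos (s * (θ n - θ m))).le
      rw [← mul_assoc, ← Real.exp_add, ← add_mul, add_neg_cancel, zero_mul, Real.exp_zero,
        one_mul] at h3
      refine h3.trans_eq ?_
      rw [show (-s - lam) * (θ m - θ n) = s * (θ n - θ m) + -lam * (θ m - θ n) by ring,
        Real.exp_add]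
      ring
  · rintro ⟨P, K, lam, hK, hlam, hP, hd⟩
    have hPP : ∀ y, P (P y) = P y := fun y => congrArg (fun F : E →L[ℝ] E => F y) hP
    set Q : ℕ → (E →L[ℝ] E) := fun n =>
      (coc A n b : E →L[ℝ] E).comp (P.comp ((coc A n b).symm : E →L[ℝ] E)) with hQ
    have hQapp : ∀ n y, Q n (coc A n b y) = coc A n b (P y) := fun n y => by
      simp [hQ]
    refine ⟨K + K₀, lam, |a₀| + |s| + lam, by positivity, hlam,
      by linarith [abs_nonneg a₀, abs_nonneg s], Q, ?_, ?_, ?_⟩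
    · intro n _
      ext1 x
      obtain ⟨y, rfl⟩ := hsurj n x
      rw [ContinuousLinearMap.comp_apply, hQapp, hQapp, hPP]
    · intro n hn
      ext1 x
      obtain ⟨y, rfl⟩ := hsurj n x
      have hcn : c n ≠ 0 := by rw [hc n hn]; exact (Real.exp_pos _).ne'
      change scale (c n) (A n) (Q n (coc A n b y)) = Q (n + 1) (scale (c n) (A n) (coc A n b y))
      rw [scale_apply hcn, scale_apply hcn, map_smul, hQapp, ← coc_succ A hn, ← coc_succ A hn,
        hQapp]
    · intro m n hn hnm x
      have hm := hn.trans hnm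
      have hle := sub_nonneg.2 (hθ m n hn hnm)
      have hKK : K ≤ K + K₀ := by linarith
      have hKK₀ : K₀ ≤ K + K₀ := by linarith
      have ha₀ := le_abs_self a₀
      have hs := le_abs_self s
      have hs' := neg_abs_le s
      have hn0 := (hN n hn).1 x
      have hm0 := (hN m hm).1 x
      have bound : ∀ {u v C p q w : ℝ}, 0 ≤ w → 0 < C → C ≤ K + K₀ → u ≤ C * Real.exp p * w →
          v + p ≤ q → Real.exp v * u ≤ (K + K₀) * Real.exp q * w := by
        intro u v C p q w hw hC hCK hu hq
        calc Real.exp v * u ≤ Real.exp v * (C * Real.exp p * w) := by gcongr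
          _ = C * Real.exp (v + p) * w := by rw [Real.exp_add]; ring
          _ ≤ _ := by gcongr
      refine ⟨?_, ?_, ?_, ?_⟩
      · obtain ⟨y, rfl⟩ := hsurj n x
        rw [hQapp, coc_scale_coc hc hm hn, hN' m hm]
        exact bound hn0 hK hKK (hd m n hn hnm y).1 (by linarith)
      · obtain ⟨y, rfl⟩ := hsurj m x
        rw [hQapp, ← map_sub, coc_scale_coc hc hn hm, hN' n hn]
        exact bound hm0 hK hKK (hd m n hn hnm y).2 (by linarith)
      · obtain ⟨y, rfl⟩ := hsurj n x
        rw [coc_scale_coc hc hm hn, hN' m hm]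
        exact bound hn0 hK₀ hKK₀ (hg m n hn hnm y).1 (by nlinarith)
      · obtain ⟨y, rfl⟩ := hsurj m x
        rw [coc_scale_coc hc hn hm, hN' n hn]
        exact bound hm0 hK₀ hKK₀ (hg m n hn hnm y).2 (by nlinarith)

theorem coc_coc_two_pow (A : ℕ → (E ≃L[ℝ] E)) (n : ℕ) (x : E) :
    coc (fun n => coc A (2 ^ (n + 1)) (2 ^ n)) n 0 x = coc A (2 ^ n) 1 x := by
  induction n with
  | zero => rw [coc_self, pow_zero, coc_self]
  | succ n ih =>
    rw [coc_succ _ n.zero_le, ih, coc_coc _ Nat.one_le_two_pow Nat.one_le_two_pow]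

/-- Corollary: joint structure of the exponential dichotomy spectrum of
`𝔹` and the polynomial dichotomy spectrum of `𝔸`. -/
theorem sigmaED_and_sigmaPD_structure {d : ℕ} (hd : 1 ≤ d)
    (A : ℕ → (EuclideanSpace ℝ (Fin d) ≃L[ℝ] EuclideanSpace ℝ (Fin d)))
    (N : ℕ → EuclideanSpace ℝ (Fin d) → ℝ)
    (hN : ∀ n : ℕ, 1 ≤ n → IsNormOn (N n))
    (K a : ℝ) (hK : 0 < K) (ha : 0 < a)
    (hbg : ∀ m n : ℕ, 1 ≤ n → n ≤ m → ∀ x : EuclideanSpace ℝ (Fin d),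
      N m (coc A m n x) ≤ K * ((m : ℝ) / n) ^ a * N n x ∧
      N n (coc A n m x) ≤ K * ((m : ℝ) / n) ^ a * N m x) :
    ∃ r : ℕ, 1 ≤ r ∧ r ≤ d ∧
      ∃ aa bb : ℕ → ℝ,
        (∀ i : ℕ, 1 ≤ i → i ≤ r → 0 < aa i ∧ aa i ≤ bb i) ∧
        (∀ i : ℕ, 1 ≤ i → i < r → bb i < aa (i + 1)) ∧
        (SigmaED (fun n : ℕ => coc A (2 ^ (n + 1)) (2 ^ n)) (fun n : ℕ => N (2 ^ n)) =
          ⋃ i ∈ Finset.Icc 1 r, Set.Icc (aa i) (bb i)) ∧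
        (SigmaPD A N =
          ⋃ i ∈ Finset.Icc 1 r,
            Set.Icc (Real.log (aa i) / Real.log 2) (Real.log (bb i) / Real.log 2)) := by
  have hlog2 : 0 < Real.log 2 := Real.log_pos one_lt_two
  set M : ℕ → EuclideanSpace ℝ (Fin d) → ℝ := fun n y => N n (coc A n 1 y) with hM
  have hMnorm : ∀ n, 1 ≤ n → IsNormOn (M n) := fun n hn => (hN n hn).comp_equiv _
  have hMg : ∀ m n : ℕ, 1 ≤ n → n ≤ m → ∀ y,
      M m y ≤ K * Real.exp (a * (Real.log m - Real.log n)) * M n y ∧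
      M n y ≤ K * Real.exp (a * (Real.log m - Real.log n)) * M m y := by
    intro m n hn hnm y
    have hn' : (0 : ℝ) < n := by exact_mod_cast hn
    have hm' : (0 : ℝ) < m := by exact_mod_cast hn.trans hnm
    have h1 := (hbg m n hn hnm (coc A n 1 y)).1
    have h2 := (hbg m n hn hnm (coc A m 1 y)).2
    rw [coc_coc A hn (hn.trans hnm), Real.rpow_def_of_pos (div_pos hm' hn'),
      Real.log_div hm'.ne' hn'.ne', mul_comm _ a] at h1
    rw [coc_coc A (hn.trans hnm) hn, Real.rpow_def_of_pos (div_pos hm' hn'),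
      Real.log_div hm'.ne' hn'.ne', mul_comm _ a] at h2
    exact ⟨h1, h2⟩
  set L : ℕ → EuclideanSpace ℝ (Fin d) → ℝ := fun n => M (2 ^ n) with hL
  have hLnorm : ∀ n, IsNormOn (L n) := fun n => hMnorm _ Nat.one_le_two_pow
  have hLg : ∀ m n : ℕ, n ≤ m → ∀ y,
      L m y ≤ K * Real.exp (a * Real.log 2 * ((m : ℝ) - n)) * L n y ∧
      L n y ≤ K * Real.exp (a * Real.log 2 * ((m : ℝ) - n)) * L m y := by
    intro m n hnm y
    have h := hMg (2 ^ m) (2 ^ n) Nat.one_le_two_pow (Nat.pow_le_pow_right two_pos hnm) y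
    push_cast at h
    rw [Real.log_pow, Real.log_pow, ← sub_mul, mul_comm _ (Real.log 2), ← mul_assoc] at h
    exact h
  have hLcoc : (fun n y => N (2 ^ n) (coc (fun n => coc A (2 ^ (n + 1)) (2 ^ n)) n 0 y)) = L := by
    funext n y
    rw [coc_coc_two_pow]
  have hED : ∀ τ : ℝ, 0 < τ →
      (StrongExpDichotomyWRT (fun n => scale τ⁻¹ (coc A (2 ^ (n + 1)) (2 ^ n)))
        (fun n => N (2 ^ n)) ↔ NormDichotomy 0 (fun n => (n : ℝ)) L (Real.log τ)) := by
    intro τ hτ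
    rw [strongExpDichotomyWRT_iff, ← hLcoc]
    refine strongDichotomy_scale_iff (c := fun _ => τ⁻¹) (K₀ := K) (a₀ := a * Real.log 2)
      (fun m n _ h => by exact_mod_cast h) (fun n _ => hN _ Nat.one_le_two_pow) hK ?_ ?_
    · intro m n _ hnm y
      rw [coc_coc_two_pow, coc_coc_two_pow]
      exact hLg m n hnm y
    · intro n _
      push_cast
      rw [add_sub_cancel_left, mul_one, Real.exp_neg, Real.exp_log hτ]
  have hPD : ∀ τ : ℝ,
      (StrongPolyDichotomyWRT (fun n => scale ((((n : ℝ) + 1) / n) ^ (-τ)) (A n)) N ↔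
        NormDichotomy 0 (fun n => (n : ℝ)) L (τ * Real.log 2)) := by
    intro τ
    rw [strongPolyDichotomyWRT_iff, ← normDichotomy_log_iff hMnorm hK ha hMg]
    refine strongDichotomy_scale_iff (c := fun n => (((n : ℝ) + 1) / n) ^ (-τ)) (K₀ := K)
      (a₀ := a) (fun m n hn h => ?_) hN hK hMg ?_
    · exact Real.log_le_log (by exact_mod_cast hn) (by exact_mod_cast h)
    · intro n hn
      have hn' : (0 : ℝ) < n := by exact_mod_cast hn
      have hn1 : (0 : ℝ) < (n : ℝ) + 1 := by positivity
      push_cast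
      rw [Real.rpow_def_of_pos (div_pos hn1 hn'), Real.log_div hn1.ne' hn'.ne', mul_comm]
  obtain ⟨r, hr1, hrd, α, β, h1, h2, h3⟩ :=
    exists_intervals_not_normDichotomy (by simpa using hd) hLnorm hK hLg
  refine ⟨r, hr1, by simpa using hrd, fun i => Real.exp (α i), fun i => Real.exp (β i),
    fun i hi hir => ⟨Real.exp_pos _, Real.exp_le_exp.2 (h1 i hi hir)⟩,
    fun i hi hir => Real.exp_lt_exp.2 (h2 i hi hir), ?_, ?_⟩
  · ext τ
    simp only [SigmaED, Set.mem_ofPred_eq, Set.mem_iUnion, Finset.mem_Icc, Set.mem_Icc,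
      exists_prop]
    constructor
    · rintro ⟨hτ, hn⟩
      rw [hED τ hτ] at hn
      obtain ⟨i, hi, hir, h4, h5⟩ := (h3 _).1 hn
      exact ⟨i, ⟨hi, hir⟩, (Real.le_log_iff_exp_le hτ).1 h4, (Real.log_le_iff_le_exp hτ).1 h5⟩
    · rintro ⟨i, ⟨hi, hir⟩, h4, h5⟩
      have hτ : 0 < τ := (Real.exp_pos _).trans_le h4
      refine ⟨hτ, ?_⟩
      rw [hED τ hτ]
      exact (h3 _).2 ⟨i, hi, hir, (Real.le_log_iff_exp_le hτ).2 h4,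
        (Real.log_le_iff_le_exp hτ).2 h5⟩
  · ext τ
    simp only [SigmaPD, Set.mem_ofPred_eq, Set.mem_iUnion, Finset.mem_Icc, Set.mem_Icc,
      exists_prop, Real.log_exp, div_le_iff₀ hlog2, le_div_iff₀ hlog2, hPD, h3, and_assoc]

end NonautLin
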